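/- Let V be an n-dimensional real vector space, W = V × V* with the form ⟨(X,α),(Y,β)⟩ = α(Y) + β(X), and let E ⊆ W be split of rank 2k with orthogonal complement E^⊥. Then dim π(E) = k if and only if there exists an alternating bilinear form B on V such that e_B(E) = π(E) × Ann(π(E^⊥)) and e_B(E^⊥) = π(E^⊥) × Ann(π(E)), where e_B(X,α) = (X, α + B(X,·)) and Ann(S) = {α ∈ V* : α vanishes on S}. -/

import Mathlib

open Module

/-- The tautological symmetric pairing on `W = V × V*`:
`⟨(X,α),(Y,β)⟩ = α(Y) + β(X)`. -/
noncomputable def pairingForm (V : Type*) [AddCommGroup V] [Module ℝ V] :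
    LinearMap.BilinForm ℝ (V × Module.Dual ℝ V) :=
  LinearMap.mk₂ ℝ (fun w w' => w.2 w'.1 + w'.2 w.1)
    (fun m₁ m₂ n => by simp; ring)
    (fun c m n => by simp [smul_add]; ring)
    (fun m n₁ n₂ => by simp; ring)
    (fun c m n => by simp [smul_add]; ring)

/-- A subspace `E ⊆ V × V*` is split of rank `2k` if it has dimension `2k` and the
restriction of the tautological pairing to it is nondegenerate of signature `(k,k)`,
i.e. nondegenerate and admitting a positive-definite subspace and a negative-definite
subspace each of dimension `k`. -/
def IsSplitOfRank {V : Type*} [AddCommGroup V] [Module ℝ V]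
    (k : ℕ) (E : Submodule ℝ (V × Module.Dual ℝ V)) : Prop :=
  Module.finrank ℝ E = 2 * k ∧
  (∀ x ∈ E, (∀ y ∈ E, pairingForm V x y = 0) → x = 0) ∧
  ∃ P N : Submodule ℝ (V × Module.Dual ℝ V), P ≤ E ∧ N ≤ E ∧
    Module.finrank ℝ P = k ∧ Module.finrank ℝ N = k ∧
    (∀ x ∈ P, x ≠ 0 → 0 < pairingForm V x x) ∧
    (∀ x ∈ N, x ≠ 0 → pairingForm V x x < 0)

/-- The copy of `V*` inside `W = V × V*`. -/
def cotSub (V : Type*) [AddCommGroup V] [Module ℝ V] :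
    Submodule ℝ (V × Module.Dual ℝ V) :=
  Submodule.prod ⊥ ⊤

/-- The projection `π : V × V* → V`. -/
noncomputable def projTan (V : Type*) [AddCommGroup V] [Module ℝ V] :
    (V × Module.Dual ℝ V) →ₗ[ℝ] V :=
  LinearMap.fst ℝ V (Module.Dual ℝ V)

/-- The B-field transform `e_B : (X,α) ↦ (X, α + B(X,·))` of `W = V × V*` determined by a
linear map `B : V → V*` (thought of as a bilinear form on `V`). -/
noncomputable def bField {V : Type*} [AddCommGroup V] [Module ℝ V]
    (B : V →ₗ[ℝ] Module.Dual ℝ V) :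
    (V × Module.Dual ℝ V) →ₗ[ℝ] (V × Module.Dual ℝ V) where
  toFun w := (w.1, w.2 + B w.1)
  map_add' a b := by
    ext <;> simp <;> abel
  map_smul' c a := by
    ext <;> simp

section PairingForm

variable {V : Type*} [AddCommGroup V] [Module ℝ V]

@[simp]
lemma pairingForm_apply (w w' : V × Module.Dual ℝ V) :
    pairingForm V w w' = w.2 w'.1 + w'.2 w.1 := rfl

@[simp]
lemma projTan_apply (w : V × Module.Dual ℝ V) : projTan V w = w.1 := rfl

@[simp]
lemma bField_apply (B : V →ₗ[ℝ] Module.Dual ℝ V) (w : V × Module.Dual ℝ V) :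
    bField B w = (w.1, w.2 + B w.1) := rfl

lemma pairingForm_isSymm : (pairingForm V).IsSymm :=
  ⟨fun w w' => by simp [add_comm]⟩

lemma pairingForm_nondegenerate : (pairingForm V).Nondegenerate := by
  refine (pairingForm_isSymm (V := V)).isRefl.nondegenerate_iff_separatingLeft.2 ?_
  rintro ⟨x, α⟩ h
  have hα : α = 0 := by
    ext y
    simpa using h (y, 0)
  have hx : x = 0 := (Module.forall_dual_apply_eq_zero_iff ℝ x).1 fun β => by
    simpa using h (0, β)
  rw [hα, hx, Prod.mk_zero_zero]

/-- An alternating `B` gives an isometry `e_B` of the pairing. -/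
lemma pairingForm_bField {B : V →ₗ[ℝ] Module.Dual ℝ V} (hB : ∀ x, B x x = 0)
    (w w' : V × Module.Dual ℝ V) :
    pairingForm V (bField B w) (bField B w') = pairingForm V w w' := by
  have h := LinearMap.IsAlt.neg hB w.1 w'.1
  simp only [pairingForm_apply, bField_apply, LinearMap.add_apply]
  linarith

lemma mem_orthogonal_pairingForm {E : Submodule ℝ (V × Module.Dual ℝ V)}
    {w : V × Module.Dual ℝ V} :
    w ∈ (pairingForm V).orthogonal E ↔ ∀ u ∈ E, u.2 w.1 + w.2 u.1 = 0 :=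
  Iff.rfl

/-- If `e_B(E)` is a product then `π(E)` and `π(E^⊥)` meet trivially. -/
lemma disjoint_map_projTan_of_map_bField_eq {E : Submodule ℝ (V × Module.Dual ℝ V)}
    (hE : ∀ x ∈ E, (∀ y ∈ E, pairingForm V x y = 0) → x = 0)
    {B : V →ₗ[ℝ] Module.Dual ℝ V} (hB : ∀ x, B x x = 0)
    (h : E.map (bField B) = (E.map (projTan V)).prod
      ((((pairingForm V).orthogonal E).map (projTan V)).dualAnnihilator)) :
    Disjoint (E.map (projTan V)) (((pairingForm V).orthogonal E).map (projTan V)) := by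
  rw [Submodule.disjoint_def]
  intro x hxF hxG
  have hx : (x, (0 : Module.Dual ℝ V)) ∈ E.map (bField B) := by
    rw [h]
    exact ⟨hxF, Submodule.zero_mem _⟩
  obtain ⟨w, hw, hwx⟩ := hx
  have hw0 : w = 0 := hE w hw fun y hy => by
    have hy' : bField B y ∈ (E.map (projTan V)).prod
        ((((pairingForm V).orthogonal E).map (projTan V)).dualAnnihilator) :=
      h ▸ Submodule.mem_map_of_mem hy
    rw [← pairingForm_bField hB, hwx]
    simpa using (Submodule.mem_dualAnnihilator _).1 hy'.2 x hxG
  simpa [hw0] using congrArg Prod.fst hwx.symm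

/-- A subspace `E` admits a linear section over `π(E)`, extended to all of `V`. -/
lemma exists_section_map_projTan (E : Submodule ℝ (V × Module.Dual ℝ V)) :
    ∃ σ : V →ₗ[ℝ] Module.Dual ℝ V, ∀ x ∈ E.map (projTan V), (x, σ x) ∈ E := by
  obtain ⟨s, hs⟩ := ((projTan V).submoduleMap E).exists_rightInverse_of_surjective
    (LinearMap.range_eq_top.2 ((projTan V).submoduleMap_surjective E))
  obtain ⟨σ, hσ⟩ := LinearMap.exists_extend
    (LinearMap.snd ℝ V (Module.Dual ℝ V) ∘ₗ E.subtype ∘ₗ s)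
  refine ⟨σ, fun x hx => ?_⟩
  have h₁ : (s ⟨x, hx⟩ : V × Module.Dual ℝ V).1 = x :=
    congrArg Subtype.val (LinearMap.congr_fun hs ⟨x, hx⟩)
  have h₂ : σ x = (s ⟨x, hx⟩ : V × Module.Dual ℝ V).2 := LinearMap.congr_fun hσ ⟨x, hx⟩
  rw [h₂]
  nth_rewrite 1 [← h₁]
  exact (s ⟨x, hx⟩).2

/-- If `V = F ⊕ G`, every bilinear form on `V` agrees on `F × G` with an alternating one. -/
lemma exists_alternating_eq_on_isCompl {F G : Submodule ℝ V} (h : IsCompl F G)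
    (σ : V →ₗ[ℝ] Module.Dual ℝ V) :
    ∃ B : V →ₗ[ℝ] Module.Dual ℝ V, (∀ x, B x x = 0) ∧ ∀ x ∈ F, ∀ z ∈ G, B x z = σ x z := by
  let C : V →ₗ[ℝ] V →ₗ[ℝ] ℝ := σ.compl₁₂ (F.projection G h) (G.projection F h.symm)
  refine ⟨C - C.flip, fun x => by simp, fun x hx z hz => ?_⟩
  simp [C, Submodule.projection_apply_of_mem_left _ hx,
    Submodule.projection_apply_of_mem_left _ hz,
    (Submodule.projection_apply_eq_zero_iff h).2 hz]

variable [FiniteDimensional ℝ V]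

lemma mem_iff_forall_mem_orthogonal {E : Submodule ℝ (V × Module.Dual ℝ V)}
    {w : V × Module.Dual ℝ V} :
    w ∈ E ↔ ∀ u ∈ (pairingForm V).orthogonal E, u.2 w.1 + w.2 u.1 = 0 := by
  rw [← mem_orthogonal_pairingForm, LinearMap.BilinForm.orthogonal_orthogonal
    pairingForm_nondegenerate pairingForm_isSymm.isRefl]

/-- The intersection of `E` with `V*` is the annihilator of `π(E^⊥)`. -/
lemma comap_inr_eq_dualAnnihilator (E : Submodule ℝ (V × Module.Dual ℝ V)) :
    E.comap (LinearMap.inr ℝ V (Module.Dual ℝ V)) =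
      (((pairingForm V).orthogonal E).map (projTan V)).dualAnnihilator := by
  ext α
  rw [Submodule.mem_comap, mem_iff_forall_mem_orthogonal, Submodule.mem_dualAnnihilator]
  simp

lemma finrank_map_projTan_add_finrank (E : Submodule ℝ (V × Module.Dual ℝ V)) :
    finrank ℝ (E.map (projTan V)) + finrank ℝ V =
      finrank ℝ E + finrank ℝ (((pairingForm V).orthogonal E).map (projTan V)) := by
  have hrank := LinearMap.finrank_range_add_finrank_ker (K := ℝ) (V := E)
    ((projTan V).domRestrict E)
  have hmap : (LinearMap.ker ((projTan V).domRestrict E)).map E.subtype =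
      (E.comap (LinearMap.inr ℝ V (Module.Dual ℝ V))).map
        (LinearMap.inr ℝ V (Module.Dual ℝ V)) := by
    ext ⟨x, α⟩
    simp +contextual
  have hker : finrank ℝ (LinearMap.ker ((projTan V).domRestrict E)) =
      finrank ℝ (E.comap (LinearMap.inr ℝ V (Module.Dual ℝ V))) := by
    rw [(Submodule.equivMapOfInjective _ E.subtype_injective _).finrank_eq,
      (Submodule.equivMapOfInjective (LinearMap.inr ℝ V (Module.Dual ℝ V))
        LinearMap.inr_injective _).finrank_eq, hmap]
  rw [LinearMap.range_domRestrict, hker, comap_inr_eq_dualAnnihilator] at hrank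
  have hann := Subspace.finrank_add_finrank_dualAnnihilator_eq
    (((pairingForm V).orthogonal E).map (projTan V))
  omega

lemma IsSplitOfRank.isCompl_orthogonal {k : ℕ} {E : Submodule ℝ (V × Module.Dual ℝ V)}
    (hE : IsSplitOfRank k E) : IsCompl E ((pairingForm V).orthogonal E) := by
  rw [LinearMap.BilinForm.isCompl_orthogonal_iff_disjoint pairingForm_isSymm.isRefl,
    Submodule.disjoint_def]
  exact fun x hx hx' => hE.2.1 x hx fun y hy => by
    rw [pairingForm_isSymm.eq_iff]
    exact hx' y hy

lemma IsSplitOfRank.codisjoint_map_projTan {k : ℕ} {E : Submodule ℝ (V × Module.Dual ℝ V)}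
    (hE : IsSplitOfRank k E) :
    Codisjoint (E.map (projTan V)) (((pairingForm V).orthogonal E).map (projTan V)) := by
  rw [codisjoint_iff, ← Submodule.map_sup, hE.isCompl_orthogonal.sup_eq_top,
    Submodule.map_top]
  exact Submodule.range_fst

lemma IsSplitOfRank.finrank_map_projTan_eq_iff {k : ℕ}
    {E : Submodule ℝ (V × Module.Dual ℝ V)} (hE : IsSplitOfRank k E) :
    finrank ℝ (E.map (projTan V)) = k ↔
      Disjoint (E.map (projTan V)) (((pairingForm V).orthogonal E).map (projTan V)) := by
  have hE' := finrank_map_projTan_add_finrank E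
  have hsup := Submodule.finrank_sup_add_finrank_inf_eq (E.map (projTan V))
    (((pairingForm V).orthogonal E).map (projTan V))
  rw [hE.codisjoint_map_projTan.eq_top, finrank_top] at hsup
  rw [hE.1] at hE'
  rw [disjoint_iff, ← Submodule.finrank_eq_zero (R := ℝ)]
  omega

lemma exists_bField_of_isCompl {E : Submodule ℝ (V × Module.Dual ℝ V)}
    (h : IsCompl (E.map (projTan V)) (((pairingForm V).orthogonal E).map (projTan V))) :
    ∃ B : V →ₗ[ℝ] Module.Dual ℝ V, (∀ x : V, B x x = 0) ∧
      E.map (bField B) =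
        (E.map (projTan V)).prod
          ((((pairingForm V).orthogonal E).map (projTan V)).dualAnnihilator) ∧
      ((pairingForm V).orthogonal E).map (bField B) =
        (((pairingForm V).orthogonal E).map (projTan V)).prod
          ((E.map (projTan V)).dualAnnihilator) := by
  obtain ⟨σ, hσ⟩ := exists_section_map_projTan E
  obtain ⟨B, hB, hBσ⟩ := exists_alternating_eq_on_isCompl h (-σ)
  have hBF {u w : V × Module.Dual ℝ V} (hu : u ∈ E)
      (hw : w ∈ (pairingForm V).orthogonal E) : B u.1 w.1 = w.2 u.1 := by
    have hu' := Submodule.mem_map_of_mem (f := projTan V) hu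
    have := mem_orthogonal_pairingForm.1 hw _ (hσ _ hu')
    have h' := hBσ _ hu' _ (Submodule.mem_map_of_mem hw)
    simp only [projTan_apply, LinearMap.neg_apply] at this h'
    linarith
  have hBG {u w : V × Module.Dual ℝ V} (hu : u ∈ E)
      (hw : w ∈ (pairingForm V).orthogonal E) : B w.1 u.1 = u.2 w.1 := by
    have h₁ := mem_orthogonal_pairingForm.1 hw _ hu
    have h₂ := LinearMap.IsAlt.neg hB u.1 w.1
    have h₃ := hBF hu hw
    linarith
  have hswap (x y : V) : B x y = -B y x := (LinearMap.IsAlt.neg hB y x).symm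
  refine ⟨B, hB, le_antisymm ?_ ?_, le_antisymm ?_ ?_⟩
  · rintro _ ⟨u, hu, rfl⟩
    refine ⟨Submodule.mem_map_of_mem hu, (Submodule.mem_dualAnnihilator _).2 ?_⟩
    rintro _ ⟨w, hw, rfl⟩
    simp [hswap u.1, hBG hu hw]
  · rintro ⟨_, α⟩ ⟨⟨u, hu, rfl⟩, hα⟩
    refine ⟨(u.1, α - B u.1), mem_iff_forall_mem_orthogonal.2 fun w hw => ?_, by simp⟩
    have hα' : α w.1 = 0 :=
      (Submodule.mem_dualAnnihilator _).1 hα _ (Submodule.mem_map_of_mem hw)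
    simp [hα', hBF hu hw]
  · rintro _ ⟨w, hw, rfl⟩
    refine ⟨Submodule.mem_map_of_mem hw, (Submodule.mem_dualAnnihilator _).2 ?_⟩
    rintro _ ⟨u, hu, rfl⟩
    simp [hswap w.1, hBF hu hw]
  · rintro ⟨_, α⟩ ⟨⟨w, hw, rfl⟩, hα⟩
    refine ⟨(w.1, α - B w.1), mem_orthogonal_pairingForm.2 fun u hu => ?_, by simp⟩
    have hα' : α u.1 = 0 :=
      (Submodule.mem_dualAnnihilator _).1 hα _ (Submodule.mem_map_of_mem hu)
    simp [hα', hBG hu hw]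

end PairingForm

/-- Proposition 26, 1) ⇔ 4) (pointwise form): for a split subspace `E` of rank `2k`,
`dim π(E) = k` if and only if there is an alternating bilinear form `B` on `V` with
`e_B(E) = π(E) × Ann(π(E^⊥))` and `e_B(E^⊥) = π(E^⊥) × Ann(π(E))`. -/
theorem stmt9 {V : Type*} [AddCommGroup V] [Module ℝ V] [FiniteDimensional ℝ V]
    (k : ℕ) (E : Submodule ℝ (V × Module.Dual ℝ V)) (hE : IsSplitOfRank k E) :
    Module.finrank ℝ (E.map (projTan V)) = k ↔
      ∃ B : V →ₗ[ℝ] Module.Dual ℝ V, (∀ x : V, B x x = 0) ∧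
        E.map (bField B) =
          (E.map (projTan V)).prod
            ((((pairingForm V).orthogonal E).map (projTan V)).dualAnnihilator) ∧
        ((pairingForm V).orthogonal E).map (bField B) =
          (((pairingForm V).orthogonal E).map (projTan V)).prod
            ((E.map (projTan V)).dualAnnihilator) := by
  rw [hE.finrank_map_projTan_eq_iff]
  exact ⟨fun h => exists_bField_of_isCompl ⟨h, hE.codisjoint_map_projTan⟩,
    fun ⟨_, hB, h, _⟩ => disjoint_map_projTan_of_map_bField_eq hE.2.1 hB h⟩
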